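/- (The passage property.) Let t denote either of the two families of looping elements, i.e., t_l = 𝒯_l for all l, or t_l = τ_l for all l. Then for all i ∈ {1,…,n−1}, l ∈ {1,…,n} and ε, ζ ∈ {1,−1}, the element gᵢ^ε t_l^ζ of H_{2,n}(q) lies in the ℤ[q,q⁻¹]-submodule spanned by the six elements t_l^ζ gᵢ^ε, tᵢ^ζ gᵢ^ε, t_{i+1}^ζ gᵢ^ε, t_l^ζ, tᵢ^ζ, t_{i+1}^ζ. In particular, in passing gᵢ^ε to the right past a looping, the index of the looping either stays equal to l or becomes i or i+1. (Lemma 2, item (7).) -/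

import Mathlib

noncomputable section

namespace MixedHecke

/-- The ring `ℤ[q,q⁻¹]` of Laurent polynomials over `ℤ`. -/
abbrev R : Type := LaurentPolynomial ℤ

/-- The variable `q`. -/
def q : R := LaurentPolynomial.T 1

/-- The inverse `q⁻¹` of the variable `q`. -/
def qinv : R := LaurentPolynomial.T (-1)

/-- Generators of the mixed braid group `B_{2,n}`:
`Sum.inl true` is `𝒯`, `Sum.inl false` is `τ`, and `Sum.inr ⟨i, _⟩` is `σ_i` for `1 ≤ i ≤ n-1`. -/
def Gen (n : ℕ) : Type := Bool ⊕ {i : ℕ // 1 ≤ i ∧ i < n}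

/-- The generator `𝒯` in the free group. -/
def fT (n : ℕ) : FreeGroup (Gen n) := FreeGroup.of (Sum.inl true)

/-- The generator `τ` in the free group. -/
def ftau (n : ℕ) : FreeGroup (Gen n) := FreeGroup.of (Sum.inl false)

/-- The generator `σ_i` in the free group (junk value `1` for `i` out of range). -/
def fs (n i : ℕ) : FreeGroup (Gen n) :=
  if h : 1 ≤ i ∧ i < n then FreeGroup.of (Sum.inr ⟨i, h⟩) else 1

/-- The defining relators of the mixed braid group `B_{2,n}`. -/
def rels (n : ℕ) : Set (FreeGroup (Gen n)) :=
  { x | (∃ k j, 1 ≤ j ∧ j + 1 < k ∧ k < n ∧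
          x = fs n k * fs n j * (fs n j * fs n k)⁻¹) ∨
        (∃ k, 1 ≤ k ∧ k + 1 < n ∧
          x = fs n k * fs n (k+1) * fs n k * (fs n (k+1) * fs n k * fs n (k+1))⁻¹) ∨
        (∃ k, 2 ≤ k ∧ k < n ∧ x = fT n * fs n k * (fs n k * fT n)⁻¹) ∨
        (∃ k, 2 ≤ k ∧ k < n ∧ x = ftau n * fs n k * (fs n k * ftau n)⁻¹) ∨
        (1 < n ∧ x = fT n * fs n 1 * fT n * fs n 1 * (fs n 1 * fT n * fs n 1 * fT n)⁻¹) ∨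
        (1 < n ∧ x = ftau n * fs n 1 * ftau n * fs n 1 * (fs n 1 * ftau n * fs n 1 * ftau n)⁻¹) ∨
        (1 < n ∧ x = ftau n * (fs n 1 * fT n * fs n 1) * ((fs n 1 * fT n * fs n 1) * ftau n)⁻¹) }

/-- The mixed braid group `B_{2,n}` on two fixed strands. -/
abbrev B (n : ℕ) : Type := PresentedGroup (rels n)

/-- The group algebra `ℤ[q,q⁻¹] B_{2,n}`. -/
abbrev GA (n : ℕ) : Type := MonoidAlgebra R (B n)

/-- The image of `σ_i` in the group algebra. -/
def gA (n i : ℕ) : GA n := MonoidAlgebra.of R (B n) (PresentedGroup.mk (rels n) (fs n i))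

/-- The quadratic relations `σ_i² = (q-1)σ_i + q·1`, `i = 1, …, n-1`. -/
inductive quadRel (n : ℕ) : GA n → GA n → Prop
  | intro (i : ℕ) (h1 : 1 ≤ i) (h2 : i < n) :
      quadRel n (gA n i * gA n i) ((q - 1) • gA n i + q • (1 : GA n))

/-- The mixed Hecke algebra `H_{2,n}(q)`: the quotient of the group algebra `ℤ[q,q⁻¹] B_{2,n}`
by the two-sided ideal generated by the quadratic relations. -/
abbrev H (n : ℕ) : Type := RingQuot (quadRel n)

/-- The canonical monoid homomorphism `B_{2,n} →* H_{2,n}(q)`. -/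
def π (n : ℕ) : B n →* H n :=
  (RingQuot.mkAlgHom R (quadRel n)).toMonoidHom.comp (MonoidAlgebra.of R (B n))

/-- The canonical map from the free group on the generators to the units of `H_{2,n}(q)`
(images of group elements are units). -/
def U (n : ℕ) : FreeGroup (Gen n) →* (H n)ˣ :=
  ((π n).comp (PresentedGroup.mk (rels n))).toHomUnits

/-- The braiding generator `g_i` as a unit of `H_{2,n}(q)`. -/
def g (n i : ℕ) : (H n)ˣ := U n (fs n i)

/-- The word for the looping element `𝒯_i` : `𝒯_1 = 𝒯` and `𝒯_{i+1} = σ_i 𝒯_i σ_i`,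
i.e. `𝒯_i = σ_{i-1} ⋯ σ_1 𝒯 σ_1 ⋯ σ_{i-1}`. -/
def wT (n : ℕ) : ℕ → FreeGroup (Gen n)
  | 0 => 1
  | 1 => fT n
  | (i+2) => fs n (i+1) * wT n (i+1) * fs n (i+1)

/-- The word for the looping element `τ_i` : `τ_1 = τ` and `τ_{i+1} = σ_i τ_i σ_i`,
i.e. `τ_i = σ_{i-1} ⋯ σ_1 τ σ_1 ⋯ σ_{i-1}`. -/
def wtau (n : ℕ) : ℕ → FreeGroup (Gen n)
  | 0 => 1
  | 1 => ftau n
  | (i+2) => fs n (i+1) * wtau n (i+1) * fs n (i+1)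

/-- The looping element `𝒯_i` as a unit of `H_{2,n}(q)`. -/
def T (n i : ℕ) : (H n)ˣ := U n (wT n i)

/-- The looping element `τ_i` as a unit of `H_{2,n}(q)`. -/
def tau (n i : ℕ) : (H n)ˣ := U n (wtau n i)

/-- The loopings of index `i` : `𝒯_i, τ_i, 𝒯_i⁻¹, τ_i⁻¹`, as units of `H_{2,n}(q)`. -/
def LoopU (n i : ℕ) : Set (H n)ˣ := {T n i, tau n i, (T n i)⁻¹, (tau n i)⁻¹}

/-- The braiding generators `g_i`, `1 ≤ i ≤ n-1`, as elements of `H_{2,n}(q)`. -/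
def BraidGens (n : ℕ) : Set (H n) := {x | ∃ i, 1 ≤ i ∧ i < n ∧ x = (g n i : H n)}

/-- The elements `g_i^{±1}` with `lo ≤ i ≤ hi - 1`, as elements of `H_{2,n}(q)`. -/
def BraidPM (n lo hi : ℕ) : Set (H n) :=
  {x | ∃ i, lo ≤ i ∧ i < hi ∧ (x = (g n i : H n) ∨ x = ((g n i)⁻¹ : (H n)ˣ))}


/-- In a group, if `s` satisfies the braid relations below `n` and `t` is a family of loopings
with `t (j+1) = s j * t j * s j`, then `s i` commutes with `t l` for `l ≠ i, i + 1`. -/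
theorem commute_looping {G : Type*} [Group G] {n : ℕ} {s t : ℕ → G}
    (far : ∀ k j, 1 ≤ j → j + 1 < k → k < n → Commute (s k) (s j))
    (braid : ∀ k, 1 ≤ k → k + 1 < n → s k * s (k + 1) * s k = s (k + 1) * s k * s (k + 1))
    (base : ∀ k, 2 ≤ k → k < n → Commute (s k) (t 1))
    (step : ∀ j, 1 ≤ j → t (j + 1) = s j * t j * s j)
    {i l : ℕ} (hi1 : 1 ≤ i) (hi2 : i < n) (hl1 : 1 ≤ l) (hl2 : l ≤ n)
    (hli : l ≠ i) (hli' : l ≠ i + 1) : Commute (s i) (t l) := by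
  have below : ∀ l, 1 ≤ l → ∀ i, l < i → i < n → Commute (s i) (t l) := by
    intro l hl
    induction l, hl using Nat.le_induction with
    | base => exact fun i hi hin => base i hi hin
    | succ l hl ih =>
      intro i hi hin
      have h := far i l hl hi hin
      rw [step l hl]
      exact (h.mul_right (ih i (by lia) hin)).mul_right h
  have above : ∀ l, i + 2 ≤ l → l ≤ n → Commute (s i) (t l) := by
    intro l hl
    induction l, hl using Nat.le_induction with
    | base =>
      intro hn
      have hb := braid i hi1 (by lia)
      have hc := (below i hi1 (i + 1) (by lia) (by lia)).eq
      rw [step (i + 1) (by lia), step i hi1]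
      calc s i * (s (i + 1) * (s i * t i * s i) * s (i + 1))
          = (s i * s (i + 1) * s i) * t i * s i * s (i + 1) := by simp only [mul_assoc]
        _ = s (i + 1) * s i * (s (i + 1) * t i) * s i * s (i + 1) := by
            rw [hb]; simp only [mul_assoc]
        _ = s (i + 1) * s i * t i * (s (i + 1) * s i * s (i + 1)) := by
            rw [hc]; simp only [mul_assoc]
        _ = s (i + 1) * (s i * t i * s i) * s (i + 1) * s i := by
            rw [← hb]; simp only [mul_assoc]
    | succ l hl ih =>
      intro hn
      have h := (far l i hi1 (by lia) (by lia)).symm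
      rw [step l (by lia)]
      exact (h.mul_right (ih (by lia))).mul_right h
  rcases lt_or_gt_of_ne hli with h | h
  · exact below l hl1 i h hi2
  · exact above l (by lia) hl2

/-- If `y = u x u` and `u`, `u⁻¹` are affine combinations of each other, then a submodule
containing `x w`, `y w`, `x`, `y` contains `w x` and `w y`, for `w = u` or `w = u⁻¹`. -/
theorem mul_mem_of_conj {S A : Type*} [CommSemiring S] [Semiring A] [Algebra S A] {u x y : Aˣ}
    {a b c d : S} (hy : y = u * x * u) (hu : (u : A) = a • 1 + b • (u⁻¹ : Aˣ))
    (hu' : ((u⁻¹ : Aˣ) : A) = c • 1 + d • (u : A)) (M : Submodule S A) {w z : Aˣ}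
    (hw : w = u ∨ w = u⁻¹) (hz : z = x ∨ z = y) (hxw : (x : A) * w ∈ M) (hyw : (y : A) * w ∈ M)
    (hxM : (x : A) ∈ M) (hyM : (y : A) ∈ M) : (w : A) * z ∈ M := by
  have hux : (u : A) * x = y * (u⁻¹ : Aˣ) := by
    rw [← Units.val_mul, ← Units.val_mul, hy, mul_inv_cancel_right]
  have huy : ((u⁻¹ : Aˣ) : A) * y = x * u := by
    rw [← Units.val_mul, ← Units.val_mul, hy, mul_assoc, inv_mul_cancel_left]
  have comb : ∀ (r r' : S) {m m' : A}, m ∈ M → m' ∈ M → r • m + r' • m' ∈ M :=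
    fun r r' _ _ h h' => M.add_mem (M.smul_mem r h) (M.smul_mem r' h')
  rcases hw with rfl | rfl <;> rcases hz with rfl | rfl
  · rw [hux, hu', mul_add, mul_smul_comm, mul_smul_comm, mul_one]
    exact comb _ _ hyM hyw
  · rw [hu, add_mul, smul_mul_assoc, smul_mul_assoc, one_mul, huy]
    exact comb _ _ hyM hxw
  · rw [hu', add_mul, smul_mul_assoc, smul_mul_assoc, one_mul, hux]
    exact comb _ _ hxM hyw
  · rw [huy, hu, mul_add, mul_smul_comm, mul_smul_comm, mul_one]
    exact comb _ _ hxM hxw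

theorem U_eq_of_mem_rels {n : ℕ} {x y : FreeGroup (Gen n)} (h : x * y⁻¹ ∈ rels n) :
    U n x = U n y := by
  have h' : PresentedGroup.mk (rels n) x = PresentedGroup.mk (rels n) y := by
    rw [← mul_inv_eq_one, ← map_inv, ← map_mul]
    exact PresentedGroup.one_of_mem h
  ext
  exact congrArg (π n) h'

theorem g_far (n k j : ℕ) (hj : 1 ≤ j) (hjk : j + 1 < k) (hk : k < n) :
    Commute (g n k) (g n j) := by
  have h := U_eq_of_mem_rels (n := n) (Or.inl ⟨k, j, hj, hjk, hk, rfl⟩)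
  simp only [map_mul] at h
  exact h

theorem g_braid (n k : ℕ) (hk : 1 ≤ k) (hkn : k + 1 < n) :
    g n k * g n (k + 1) * g n k = g n (k + 1) * g n k * g n (k + 1) := by
  have h := U_eq_of_mem_rels (n := n) (Or.inr (Or.inl ⟨k, hk, hkn, rfl⟩))
  simp only [map_mul] at h
  exact h

theorem g_commute_T_one (n k : ℕ) (hk : 2 ≤ k) (hkn : k < n) : Commute (g n k) (T n 1) := by
  have h := U_eq_of_mem_rels (n := n) (Or.inr (Or.inr (Or.inl ⟨k, hk, hkn, rfl⟩)))
  simp only [map_mul] at h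
  exact h.symm

theorem g_commute_tau_one (n k : ℕ) (hk : 2 ≤ k) (hkn : k < n) :
    Commute (g n k) (tau n 1) := by
  have h := U_eq_of_mem_rels (n := n) (Or.inr (Or.inr (Or.inr (Or.inl ⟨k, hk, hkn, rfl⟩))))
  simp only [map_mul] at h
  exact h.symm

theorem T_succ (n j : ℕ) (hj : 1 ≤ j) : T n (j + 1) = g n j * T n j * g n j := by
  obtain ⟨j, rfl⟩ := Nat.exists_eq_add_of_le' hj
  simp only [T, g, wT, map_mul]

theorem tau_succ (n j : ℕ) (hj : 1 ≤ j) : tau n (j + 1) = g n j * tau n j * g n j := by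
  obtain ⟨j, rfl⟩ := Nat.exists_eq_add_of_le' hj
  simp only [tau, g, wtau, map_mul]

theorem g_mul_self (n i : ℕ) (h1 : 1 ≤ i) (h2 : i < n) :
    (g n i : H n) * g n i = (q - 1) • (g n i : H n) + q • (1 : H n) := by
  have h := RingQuot.mkAlgHom_rel R (quadRel.intro i h1 h2)
  simp only [map_mul, map_add, map_smul, map_one] at h
  exact h

theorem qinv_mul_q : qinv * q = 1 := by
  rw [qinv, q, ← LaurentPolynomial.T_add, neg_add_cancel, LaurentPolynomial.T_zero]

theorem g_eq (n i : ℕ) (h1 : 1 ≤ i) (h2 : i < n) :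
    (g n i : H n) = (q - 1) • (1 : H n) + q • (((g n i)⁻¹ : (H n)ˣ) : H n) := by
  have h := congrArg (· * (((g n i)⁻¹ : (H n)ˣ) : H n)) (g_mul_self n i h1 h2)
  simpa only [add_mul, smul_mul_assoc, one_mul, mul_assoc, Units.mul_inv, mul_one] using h

theorem g_inv_eq (n i : ℕ) (h1 : 1 ≤ i) (h2 : i < n) :
    (((g n i)⁻¹ : (H n)ˣ) : H n) = (qinv - 1) • (1 : H n) + qinv • (g n i : H n) := by
  rw [g_eq n i h1 h2, smul_add, smul_smul, smul_smul, mul_sub, qinv_mul_q, mul_one, one_smul,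
    ← add_assoc, ← add_smul, sub_add_sub_cancel, sub_self, zero_smul, zero_add]

/-- **Lemma 2, item (7): the passage property.** For either family of looping elements
(`t_l = 𝒯_l` for all `l`, or `t_l = τ_l` for all `l`), the element `g_i^ε t_l^ζ` lies in the
`ℤ[q,q⁻¹]`-submodule spanned by `t_l^ζ g_i^ε, t_i^ζ g_i^ε, t_{i+1}^ζ g_i^ε, t_l^ζ, t_i^ζ,
t_{i+1}^ζ`. -/
theorem passage (n : ℕ) (hn : 1 ≤ n) (tL : ℕ → (H n)ˣ) (htL : tL = T n ∨ tL = tau n)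
    (i l : ℕ) (hi1 : 1 ≤ i) (hi2 : i < n) (hl1 : 1 ≤ l) (hl2 : l ≤ n)
    (ε ζ : ℤ) (hε : ε = 1 ∨ ε = -1) (hζ : ζ = 1 ∨ ζ = -1) :
    ((g n i ^ ε : (H n)ˣ) : H n) * ((tL l ^ ζ : (H n)ˣ) : H n) ∈
      Submodule.span R
        ({((tL l ^ ζ : (H n)ˣ) : H n) * ((g n i ^ ε : (H n)ˣ) : H n),
          ((tL i ^ ζ : (H n)ˣ) : H n) * ((g n i ^ ε : (H n)ˣ) : H n),
          ((tL (i+1) ^ ζ : (H n)ˣ) : H n) * ((g n i ^ ε : (H n)ˣ) : H n),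
          ((tL l ^ ζ : (H n)ˣ) : H n),
          ((tL i ^ ζ : (H n)ˣ) : H n),
          ((tL (i+1) ^ ζ : (H n)ˣ) : H n)} : Set (H n)) := by
  have hcomm : l ≠ i → l ≠ i + 1 → Commute (g n i) (tL l) := by
    intro h h'
    rcases htL with rfl | rfl
    · exact commute_looping (g_far n) (g_braid n) (g_commute_T_one n) (T_succ n)
        hi1 hi2 hl1 hl2 h h'
    · exact commute_looping (g_far n) (g_braid n) (g_commute_tau_one n) (tau_succ n)
        hi1 hi2 hl1 hl2 h h'
  have hsucc : tL (i + 1) = g n i * tL i * g n i := by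
    rcases htL with rfl | rfl
    · exact T_succ n i hi1
    · exact tau_succ n i hi1
  have hg := g_eq n i hi1 hi2
  have hg' := g_inv_eq n i hi1 hi2
  by_cases hl : l = i ∨ l = i + 1
  · have hz : tL l ^ ζ = tL i ^ ζ ∨ tL l ^ ζ = tL (i + 1) ^ ζ :=
      hl.imp (fun h => by rw [h]) (fun h => by rw [h])
    have hw : g n i ^ ε = g n i ∨ g n i ^ ε = (g n i)⁻¹ :=
      hε.imp (fun h => by rw [h, zpow_one]) (fun h => by rw [h, zpow_neg_one])
    rcases hζ with rfl | rfl
    · have hy : tL (i + 1) ^ (1 : ℤ) = g n i * tL i ^ (1 : ℤ) * g n i := by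
        simpa only [zpow_one] using hsucc
      apply mul_mem_of_conj hy hg hg' _ hw hz <;> apply Submodule.subset_span <;> simp
    · have hy : tL (i + 1) ^ (-1 : ℤ) = (g n i)⁻¹ * tL i ^ (-1 : ℤ) * (g n i)⁻¹ := by
        rw [zpow_neg_one, zpow_neg_one, hsucc, mul_inv_rev, mul_inv_rev, mul_assoc]
      rw [← inv_inv (g n i)] at hg
      apply mul_mem_of_conj hy hg' hg _ (by rw [inv_inv]; exact hw.symm) hz <;>
        apply Submodule.subset_span <;> simp
  · rw [not_or] at hl
    have h := ((hcomm hl.1 hl.2).zpow_zpow ε ζ).eq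
    have h' := congrArg Units.val h
    rw [Units.val_mul, Units.val_mul] at h'
    rw [h']
    exact Submodule.subset_span (Set.mem_insert _ _)

end MixedHecke
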